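/- Let (X, A_X) be a finite network and let t ≥ 2 be an integer. Then the semi-reciprocal function u^{SR(t)} satisfies the strong triangle inequality: for all x, x', x'' ∈ X, u^{SR(t)}(x,x') ≤ max(u^{SR(t)}(x,x''), u^{SR(t)}(x'',x')); together with its symmetry and identity properties this makes it a valid ultrametric on X. -/

import Mathlib

noncomputable section

/-- Cost of a chain (a finite ordered list of nodes): the maximum dissimilarity
encountered over consecutive pairs (0 for chains with fewer than two nodes). -/
def chainCost {X : Type*} (A : X → X → ℝ) : List X → ℝ
  | [] => 0
  | [_] => 0
  | a :: b :: rest => max (A a b) (chainCost A (b :: rest))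

/-- The set of costs of chains from `x` to `x'`. -/
def chainCosts {X : Type*} (A : X → X → ℝ) (x x' : X) : Set ℝ :=
  { c | ∃ l : List X, l.head? = some x ∧ l.getLast? = some x' ∧ chainCost A l = c }

/-- Directed minimum chain cost ũ*(x,x'). -/
def minChainCost {X : Type*} (A : X → X → ℝ) (x x' : X) : ℝ :=
  sInf (chainCosts A x x')

/-- The reciprocal ultrametric u^R. -/
def uR {X : Type*} (A : X → X → ℝ) (x x' : X) : ℝ :=
  minChainCost (fun a b => max (A a b) (A b a)) x x'

/-- The nonreciprocal ultrametric u^NR. -/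
def uNR {X : Type*} (A : X → X → ℝ) (x x' : X) : ℝ :=
  max (minChainCost A x x') (minChainCost A x' x)

/-- The set of costs of chains from `x` to `x'` having at most `t` nodes. -/
def boundedChainCosts {X : Type*} (A : X → X → ℝ) (t : ℕ) (x x' : X) : Set ℝ :=
  { c | ∃ l : List X, l.head? = some x ∧ l.getLast? = some x' ∧ l.length ≤ t ∧
      chainCost A l = c }

/-- A^{SR(t)}(x,x'): minimum cost over chains from `x` to `x'` with at most `t` nodes. -/
def ASR {X : Type*} (A : X → X → ℝ) (t : ℕ) (x x' : X) : ℝ :=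
  sInf (boundedChainCosts A t x x')

/-- The semi-reciprocal ultrametric u^{SR(t)}. -/
def uSR {X : Type*} (A : X → X → ℝ) (t : ℕ) (x x' : X) : ℝ :=
  minChainCost (fun a b => max (ASR A t a b) (ASR A t b a)) x x'

theorem chainCost_nonneg {X : Type*} (A : X → X → ℝ) : ∀ l : List X, 0 ≤ chainCost A l
  | [] => le_rfl
  | [_] => le_rfl
  | _ :: b :: l => (chainCost_nonneg A (b :: l)).trans (le_max_right _ _)

theorem chainCost_le_iff {X : Type*} (A : X → X → ℝ) {r : ℝ} (hr : 0 ≤ r) :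
    ∀ l : List X, chainCost A l ≤ r ↔ l.IsChain (fun a b => A a b ≤ r)
  | [] => by simpa [chainCost] using hr
  | [_] => by simpa [chainCost] using hr
  | a :: b :: l => by
    rw [chainCost, max_le_iff, chainCost_le_iff A hr (b :: l), List.isChain_cons_cons]

theorem chainCost_reverse_le {X : Type*} {A : X → X → ℝ} (hA : ∀ a b, A a b = A b a)
    (l : List X) : chainCost A l.reverse ≤ chainCost A l := by
  have h := (chainCost_le_iff A (chainCost_nonneg A l) l).1 le_rfl
  rw [chainCost_le_iff A (chainCost_nonneg A l), List.isChain_reverse]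
  exact h.imp fun a b hab => (hA b a).trans_le hab

theorem chainCost_reverse {X : Type*} {A : X → X → ℝ} (hA : ∀ a b, A a b = A b a)
    (l : List X) : chainCost A l.reverse = chainCost A l :=
  (chainCost_reverse_le hA l).antisymm (by simpa using chainCost_reverse_le hA l.reverse)

theorem chainCost_append_le {X : Type*} (A : X → X → ℝ) (l m : List X) (y : X) :
    chainCost A (l ++ y :: m) ≤ max (chainCost A (l ++ [y])) (chainCost A (y :: m)) := by
  have hr := (chainCost_nonneg A (y :: m)).trans (le_max_right (chainCost A (l ++ [y])) _)
  rw [chainCost_le_iff A hr, List.isChain_split, ← chainCost_le_iff A hr, ← chainCost_le_iff A hr]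
  exact ⟨le_max_left _ _, le_max_right _ _⟩

/-- A chain joining distinct nodes costs at least any lower bound on the off-diagonal
dissimilarities. -/
theorem le_chainCost {X : Type*} {A : X → X → ℝ} {δ : ℝ} (hδ : ∀ a b, a ≠ b → δ ≤ A a b)
    {x' : X} : ∀ (l : List X) (x : X), l.head? = some x → l.getLast? = some x' → x ≠ x' →
      δ ≤ chainCost A l
  | [], _, h, _, _ => by simp at h
  | [_], _, h, h', hne => by simp_all
  | a :: b :: l, x, h, h', hne => by
    obtain rfl : a = x := by simpa using h
    by_cases hab : a = b
    · subst hab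
      exact (le_chainCost hδ (a :: l) a rfl (by simpa using h') hne).trans (le_max_right _ _)
    · exact (hδ a b hab).trans (le_max_left _ _)

theorem bddBelow_chainCosts {X : Type*} (A : X → X → ℝ) (x x' : X) :
    BddBelow (chainCosts A x x') :=
  ⟨0, by rintro _ ⟨l, -, -, rfl⟩; exact chainCost_nonneg A l⟩

theorem chainCosts_nonempty {X : Type*} (A : X → X → ℝ) (x x' : X) :
    (chainCosts A x x').Nonempty :=
  ⟨_, [x, x'], rfl, rfl, rfl⟩

theorem minChainCost_comm {X : Type*} {A : X → X → ℝ} (hA : ∀ a b, A a b = A b a) (x x' : X) :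
    minChainCost A x x' = minChainCost A x' x := by
  have key : ∀ x x' : X, chainCosts A x x' ⊆ chainCosts A x' x := by
    rintro x x' _ ⟨l, h, h', rfl⟩
    exact ⟨l.reverse, by simpa using h', by simpa using h, chainCost_reverse hA l⟩
  exact congrArg sInf ((key x x').antisymm (key x' x))

theorem minChainCost_self {X : Type*} (A : X → X → ℝ) (x : X) : minChainCost A x x = 0 := by
  refine le_antisymm (csInf_le (bddBelow_chainCosts A x x) ⟨[x], rfl, rfl, rfl⟩)
    (le_csInf (chainCosts_nonempty A x x) ?_)
  rintro _ ⟨l, -, -, rfl⟩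
  exact chainCost_nonneg A l

theorem le_minChainCost {X : Type*} {A : X → X → ℝ} {δ : ℝ} (hδ : ∀ a b, a ≠ b → δ ≤ A a b)
    {x x' : X} (hne : x ≠ x') : δ ≤ minChainCost A x x' := by
  refine le_csInf (chainCosts_nonempty A x x') ?_
  rintro _ ⟨l, h, h', rfl⟩
  exact le_chainCost hδ l x h h' hne

theorem minChainCost_le_max {X : Type*} (A : X → X → ℝ) (x x' y : X) :
    minChainCost A x x' ≤ max (minChainCost A x y) (minChainCost A y x') := by
  refine le_of_forall_gt fun r hr => ?_
  obtain ⟨h₁, h₂⟩ := max_lt_iff.1 hr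
  obtain ⟨_, ⟨l, hl, hl', rfl⟩, hlr⟩ := exists_lt_of_csInf_lt (chainCosts_nonempty A x y) h₁
  obtain ⟨_, ⟨m, hm, hm', rfl⟩, hmr⟩ := exists_lt_of_csInf_lt (chainCosts_nonempty A y x') h₂
  obtain ⟨l, rfl⟩ := List.getLast?_eq_some_iff.1 hl'
  obtain ⟨m, rfl⟩ := List.head?_eq_some_iff.1 hm
  refine lt_of_le_of_lt (csInf_le (bddBelow_chainCosts A x x') ⟨l ++ y :: m, ?_, ?_, rfl⟩)
    ((chainCost_append_le A l m y).trans_lt (max_lt hlr hmr))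
  · cases l <;> simpa using hl
  · simpa [List.getLast?_append] using hm'

theorem le_ASR {X : Type*} {A : X → X → ℝ} {δ : ℝ} (hδ : ∀ a b, a ≠ b → δ ≤ A a b)
    {t : ℕ} (ht : 2 ≤ t) {x x' : X} (hne : x ≠ x') : δ ≤ ASR A t x x' := by
  refine le_csInf ⟨_, [x, x'], rfl, rfl, ht, rfl⟩ ?_
  rintro _ ⟨l, h, h', -, rfl⟩
  exact le_chainCost hδ l x h h' hne

theorem exists_pos_le_of_ne {X : Type*} [Finite X] {A : X → X → ℝ}
    (hA : ∀ a b, a ≠ b → 0 < A a b) : ∃ δ > 0, ∀ a b, a ≠ b → δ ≤ A a b := by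
  rcases isEmpty_or_nonempty {p : X × X // p.1 ≠ p.2} with h | h
  · exact ⟨1, one_pos, fun a b hab => (h.false ⟨(a, b), hab⟩).elim⟩
  · obtain ⟨p, hp⟩ := Finite.exists_min fun p : {p : X × X // p.1 ≠ p.2} => A p.1.1 p.1.2
    exact ⟨_, hA _ _ p.2, fun a b hab => hp ⟨(a, b), hab⟩⟩

/-- for every integer t ≥ 2, the semi-reciprocal function
u^{SR(t)} is a valid ultrametric: it is symmetric, vanishes exactly on the
diagonal, and satisfies the strong triangle inequality. -/
theorem semireciprocal_is_ultrametric {X : Type*} [Fintype X]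
    (A : X → X → ℝ)
    (hnonneg : ∀ x x' : X, 0 ≤ A x x')
    (hid : ∀ x x' : X, A x x' = 0 ↔ x = x')
    (t : ℕ) (ht : 2 ≤ t) :
    (∀ x x' : X, uSR A t x x' = uSR A t x' x) ∧
    (∀ x x' : X, uSR A t x x' = 0 ↔ x = x') ∧
    (∀ x x' x'' : X, uSR A t x x' ≤ max (uSR A t x x'') (uSR A t x'' x')) := by
  refine ⟨fun x x' => minChainCost_comm (fun a b => max_comm _ _) x x', fun x x' => ⟨?_, ?_⟩,
    fun x x' x'' => minChainCost_le_max _ x x' x''⟩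
  · intro h
    by_contra hne
    obtain ⟨δ, hpos, hδ⟩ := exists_pos_le_of_ne (A := A) fun a b hab =>
      (hnonneg a b).lt_of_ne fun h0 => hab ((hid a b).1 h0.symm)
    have hle : δ ≤ uSR A t x x' :=
      le_minChainCost (fun a b hab => (le_ASR hδ ht hab).trans (le_max_left _ _)) hne
    exact absurd (hle.trans_eq h) hpos.not_ge
  · rintro rfl
    exact minChainCost_self _ x
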